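/- Let α ∈ (0,1) be irrational and let B_k be the k-th matrix of the Minkowski chain for α (the case n = 1). Then |det B_k| = 1 for all k. -/

import Mathlib

/-- ξ(r) = p + α₁q₁ + ⋯ + αₙqₙ for r = (q₁, …, qₙ, p) ∈ ℤ^(n+1). -/
noncomputable def xi {n : ℕ} (α : Fin n → ℝ) (r : Fin (n + 1) → ℤ) : ℝ :=
  (r (Fin.last n) : ℝ) + ∑ i : Fin n, α i * (r (Fin.castSucc i) : ℝ)

/-- The real span of the rows of `A` preceding row `j`. -/
def earlierRowSpan {n : ℕ} (A : Matrix (Fin (n + 1)) (Fin (n + 1)) ℤ) (j : Fin (n + 1)) :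
    Submodule ℝ (Fin (n + 1) → ℝ) :=
  Submodule.span ℝ {x : Fin (n + 1) → ℝ | ∃ i : Fin (n + 1), i < j ∧ x = fun k => (A i k : ℝ)}

/-- `A` is the matrix produced by the Minkowski algorithm at stage `m`: each row has sup norm
at most `m`, is linearly independent of the previous rows, minimizes `|ξ|` among all integer
vectors with sup norm at most `m` that are linearly independent of the previous rows, and its
first nonzero entry is positive. -/
def IsMinkowskiMatrix {n : ℕ} (α : Fin n → ℝ) (m : ℕ)
    (A : Matrix (Fin (n + 1)) (Fin (n + 1)) ℤ) : Prop :=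
  ∀ j : Fin (n + 1),
    (∀ k, |A j k| ≤ (m : ℤ)) ∧
    (fun k => (A j k : ℝ)) ∉ earlierRowSpan A j ∧
    (∀ w : Fin (n + 1) → ℤ, (∀ k, |w k| ≤ (m : ℤ)) →
      ((fun k => (w k : ℝ)) ∉ earlierRowSpan A j) → |xi α (A j)| ≤ |xi α w|) ∧
    (∃ k₀ : Fin (n + 1), 0 < A j k₀ ∧ ∀ k < k₀, A j k = 0)

/-- `B` (indexed from 0, so `B 0 = B₁`) is the Minkowski chain of `α`: the subsequence of
distinct matrices among the matrices `A m` produced by the Minkowski algorithm, starting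
with `A 1`. -/
def IsMinkowskiChain {n : ℕ} (α : Fin n → ℝ)
    (B : ℕ → Matrix (Fin (n + 1)) (Fin (n + 1)) ℤ) : Prop :=
  ∃ (A : ℕ → Matrix (Fin (n + 1)) (Fin (n + 1)) ℤ) (idx : ℕ → ℕ),
    (∀ m, 1 ≤ m → IsMinkowskiMatrix α m (A m)) ∧
    StrictMono idx ∧ idx 0 = 1 ∧
    (∀ k, B k = A (idx k)) ∧
    (∀ k m, idx k ≤ m → m < idx (k + 1) → A m = A (idx k)) ∧
    (∀ k, A (idx (k + 1)) ≠ A (idx k))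

theorem exists_two_mul_abs_sub_mul_le (D x : ℤ) (hD : D ≠ 0) :
    ∃ s : ℤ, 2 * |x - D * s| ≤ |D| := by
  refine ⟨round ((x : ℚ) / D), ?_⟩
  have hD' : (D : ℚ) ≠ 0 := by exact_mod_cast hD
  have h := abs_sub_round ((x : ℚ) / D)
  have hx : (x : ℚ) - D * round ((x : ℚ) / D) = D * ((x : ℚ) / D - round ((x : ℚ) / D)) := by
    field_simp
  have key : 2 * |(x : ℚ) - D * round ((x : ℚ) / D)| ≤ |(D : ℚ)| := by
    rw [hx, abs_mul]
    nlinarith [abs_nonneg (D : ℚ)]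
  exact_mod_cast key

/-- If two integer vectors span a proper sublattice of full rank, some integer vector outside the
sublattice has both coordinates with respect to them at most `1 / 2` in absolute value. -/
theorem exists_mul_eq_of_abs_det_ne_one (a b c d : ℤ) (hD : a * d - b * c ≠ 0)
    (hD1 : |a * d - b * c| ≠ 1) :
    ∃ p q x y : ℤ, (a * d - b * c) * p = x * a + y * c ∧ (a * d - b * c) * q = x * b + y * d ∧
      2 * |x| ≤ |a * d - b * c| ∧ 2 * |y| ≤ |a * d - b * c| ∧ (x ≠ 0 ∨ y ≠ 0) := by
  set D := a * d - b * c with hDdef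
  have reduce : ∀ p q x y : ℤ, D * p = x * a + y * c → D * q = x * b + y * d →
      ¬(D ∣ x ∧ D ∣ y) → ∃ p q x y : ℤ, D * p = x * a + y * c ∧ D * q = x * b + y * d ∧
        2 * |x| ≤ |D| ∧ 2 * |y| ≤ |D| ∧ (x ≠ 0 ∨ y ≠ 0) := by
    intro p q x y hp hq hxy
    obtain ⟨s, hs⟩ := exists_two_mul_abs_sub_mul_le D x hD
    obtain ⟨t, ht⟩ := exists_two_mul_abs_sub_mul_le D y hD
    refine ⟨p - s * a - t * c, q - s * b - t * d, x - D * s, y - D * t, ?_, ?_, hs, ht, ?_⟩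
    · linear_combination hp
    · linear_combination hq
    · by_contra! h
      exact hxy ⟨⟨s, by linarith [h.1]⟩, ⟨t, by linarith [h.2]⟩⟩
  by_cases h₁ : D ∣ d ∧ D ∣ -b
  · by_cases h₂ : D ∣ -c ∧ D ∣ a
    · obtain ⟨⟨d', hd⟩, ⟨b', hb⟩⟩ := h₁
      obtain ⟨⟨c', hc⟩, ⟨a', ha⟩⟩ := h₂
      have h : D * (D * (a' * d' - b' * c')) = D * 1 := by
        linear_combination hDdef - D * a' * hd - d * ha + D * b' * hc - c * hb
      exact absurd (Int.isUnit_iff_abs_eq.mp (IsUnit.of_mul_eq_one _ (mul_left_cancel₀ hD h))) hD1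
    · exact reduce 0 1 (-c) a (by ring) (by rw [hDdef]; ring) h₂
  · exact reduce 1 0 d (-b) (by rw [hDdef]; ring) (by ring) h₁

theorem earlierRowSpan_zero {n : ℕ} (A : Matrix (Fin (n + 1)) (Fin (n + 1)) ℤ) :
    earlierRowSpan A 0 = ⊥ := by
  simp [earlierRowSpan]

theorem mem_earlierRowSpan_one (A : Matrix (Fin 2) (Fin 2) ℤ) (x : Fin 2 → ℝ) :
    x ∈ earlierRowSpan A 1 ↔ ∃ r : ℝ, r * A 0 0 = x 0 ∧ r * A 0 1 = x 1 := by
  have h : {x : Fin 2 → ℝ | ∃ i : Fin 2, i < 1 ∧ x = fun k => (A i k : ℝ)} =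
      {fun k => (A 0 k : ℝ)} := by
    ext
    simp
  rw [earlierRowSpan, h, Submodule.mem_span_singleton]
  simp [funext_iff, Fin.forall_fin_two]

theorem xi_fin_one (α : ℝ) (r : Fin 2 → ℤ) :
    xi (fun _ : Fin 1 => α) r = r 1 + α * r 0 := by
  simp [xi]

theorem Irrational.eq_zero_of_add_mul_eq_zero {α : ℝ} (hα : Irrational α) {p q : ℤ}
    (h : (p : ℝ) + α * q = 0) : q = 0 ∧ p = 0 := by
  have hq : q = 0 := by
    by_contra hq
    have hq' : (q : ℝ) ≠ 0 := by exact_mod_cast hq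
    refine hα ⟨-p / q, ?_⟩
    push_cast
    field_simp
    linarith
  subst hq
  exact ⟨rfl, by simpa using h⟩

theorem IsMinkowskiMatrix.abs_det_eq_one {α : ℝ} (hα : Irrational α) {m : ℕ}
    {A : Matrix (Fin 2) (Fin 2) ℤ} (hA : IsMinkowskiMatrix (fun _ : Fin 1 => α) m A) :
    |A.det| = 1 := by
  obtain ⟨hb0, hn0, hmin0, -⟩ := hA 0
  obtain ⟨hb1, hn1, hmin1, -⟩ := hA 1
  have hmem0 (w : Fin 2 → ℤ) :
      (fun k => (w k : ℝ)) ∈ earlierRowSpan A 0 ↔ w 0 = 0 ∧ w 1 = 0 := by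
    rw [earlierRowSpan_zero, Submodule.mem_bot]
    simp [funext_iff, Fin.forall_fin_two]
  rw [hmem0] at hn0
  simp only [hmem0, xi_fin_one] at hmin0
  have hmem1 (w : Fin 2 → ℤ) : (fun k => (w k : ℝ)) ∈ earlierRowSpan A 1 ↔
      ∃ r : ℝ, r * A 0 0 = w 0 ∧ r * A 0 1 = w 1 :=
    mem_earlierRowSpan_one A _
  rw [hmem1] at hn1
  simp only [hmem1, xi_fin_one] at hmin1
  rw [Matrix.det_fin_two]
  have ha := hb0 0
  have hb := hb0 1
  have hc := hb1 0
  have hd := hb1 1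
  have hu0 : ¬(A 1 0 = 0 ∧ A 1 1 = 0) := fun h => hn1 ⟨0, by simp [h.1], by simp [h.2]⟩
  have hle := hmin0 (A 1) hb1 hu0
  generalize A 0 0 = a at *
  generalize A 0 1 = b at *
  generalize A 1 0 = c at *
  generalize A 1 1 = d at *
  have hlt : |(b : ℝ) + α * a| < |(d : ℝ) + α * c| := by
    refine lt_of_le_of_ne hle fun h => hn1 ?_
    rcases abs_eq_abs.mp h with h | h
    · obtain ⟨h₁, h₂⟩ := hα.eq_zero_of_add_mul_eq_zero (p := b - d) (q := a - c)
        (by push_cast; linarith)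
      exact ⟨1, by rw [sub_eq_zero.mp h₁, one_mul], by rw [sub_eq_zero.mp h₂, one_mul]⟩
    · obtain ⟨h₁, h₂⟩ := hα.eq_zero_of_add_mul_eq_zero (p := b + d) (q := a + c)
        (by push_cast; linarith)
      refine ⟨-1, ?_, ?_⟩
      · rw [eq_neg_of_add_eq_zero_left h₁]; push_cast; ring
      · rw [eq_neg_of_add_eq_zero_left h₂]; push_cast; ring
  have hD : a * d - b * c ≠ 0 := by
    intro hD
    have hD' : (a : ℝ) * d - b * c = 0 := by exact_mod_cast hD
    apply hn1
    by_cases h : a = 0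
    · have hb' : (b : ℝ) ≠ 0 := by
        have : b ≠ 0 := fun h' => hn0 ⟨h, h'⟩
        exact_mod_cast this
      refine ⟨d / b, ?_, by field_simp⟩
      field_simp
      linarith
    · have ha' : (a : ℝ) ≠ 0 := by exact_mod_cast h
      refine ⟨c / a, by field_simp, ?_⟩
      field_simp
      linarith
  by_contra hD1
  obtain ⟨p, q, x, y, hp, hq, hx, hy, hxy⟩ := exists_mul_eq_of_abs_det_ne_one a b c d hD hD1
  generalize a * d - b * c = D at *
  have hDpos : 0 < |D| := abs_pos.mpr hD
  have bound {e f g : ℤ} (h : D * e = x * f + y * g) (hf : |f| ≤ m) (hg : |g| ≤ m) :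
      |e| ≤ m := by
    have h₁ : |D| * |e| ≤ |x| * |f| + |y| * |g| := by
      rw [← abs_mul, h, ← abs_mul, ← abs_mul]
      exact abs_add_le _ _
    have h₂ : |x| * |f| ≤ |x| * m := by gcongr
    have h₃ : |y| * |g| ≤ |y| * m := by gcongr
    nlinarith [mul_le_mul_of_nonneg_right hx (Nat.cast_nonneg (α := ℤ) m),
      mul_le_mul_of_nonneg_right hy (Nat.cast_nonneg (α := ℤ) m)]
  have hw : ∀ k, |(![p, q] : Fin 2 → ℤ) k| ≤ (m : ℤ) :=
    Fin.forall_fin_two.mpr ⟨bound hp ha hc, bound hq hb hd⟩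
  have hpR : (D : ℝ) * p = x * a + y * c := by exact_mod_cast hp
  have hqR : (D : ℝ) * q = x * b + y * d := by exact_mod_cast hq
  have hxR : 2 * |(x : ℝ)| ≤ |(D : ℝ)| := by exact_mod_cast hx
  have hyR : 2 * |(y : ℝ)| ≤ |(D : ℝ)| := by exact_mod_cast hy
  have hDR : 0 < |(D : ℝ)| := by exact_mod_cast hDpos
  have hxi : |(D : ℝ)| * |(q : ℝ) + α * p| ≤
      |(x : ℝ)| * |(b : ℝ) + α * a| + |(y : ℝ)| * |(d : ℝ) + α * c| := by
    rw [← abs_mul, ← abs_mul, ← abs_mul]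
    refine le_trans (le_of_eq ?_) (abs_add_le _ _)
    congr 1
    linear_combination hqR + α * hpR
  have hv0 : 0 < |(b : ℝ) + α * a| :=
    abs_pos.mpr fun h => hn0 (hα.eq_zero_of_add_mul_eq_zero h)
  by_cases hy0 : y = 0
  · have hpq : ¬(p = 0 ∧ q = 0) := by
      rintro ⟨rfl, rfl⟩
      have hx0 : x ≠ 0 := hxy.resolve_right (not_not.mpr hy0)
      subst hy0
      apply hn0
      simpa [hx0, eq_comm] using And.intro hp hq
    have h := hmin0 ![p, q] hw (by simpa using hpq)
    simp only [Matrix.cons_val_zero, Matrix.cons_val_one] at h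
    subst hy0
    simp only [Int.cast_zero, abs_zero, zero_mul, add_zero] at hxi
    nlinarith
  · have hyR0 : (y : ℝ) ≠ 0 := by exact_mod_cast hy0
    have h := hmin1 ![p, q] hw (by
      simp only [Matrix.cons_val_zero, Matrix.cons_val_one]
      rintro ⟨r, hr₁, hr₂⟩
      refine hn1 ⟨(D * r - x) / y, ?_, ?_⟩
      · field_simp
        linear_combination D * hr₁ + hpR
      · field_simp
        linear_combination D * hr₂ + hqR)
    simp only [Matrix.cons_val_zero, Matrix.cons_val_one] at h
    nlinarith

/-- For an irrational `α ∈ (0,1)` and the Minkowski chain `B` of `α` (the case `n = 1`),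
every matrix `B k` of the chain has determinant of absolute value one. -/
theorem minkowski_chain_det_eq_one
    (α : ℝ) (hirr : Irrational α) (h0 : 0 < α) (h1 : α < 1)
    (B : ℕ → Matrix (Fin 2) (Fin 2) ℤ)
    (hB : IsMinkowskiChain (fun _ : Fin 1 => α) B)
    (k : ℕ) :
    |(B k).det| = 1 := by
  obtain ⟨A, idx, hA, hmono, hidx, hBA, -, -⟩ := hB
  rw [hBA k]
  exact (hA _ (hidx ▸ hmono.monotone k.zero_le)).abs_det_eq_one hirr
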